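/- Let s > 0 and let E ⊆ ℝ^d be a mid-point convex Borel set. If x, y ∈ E and the upper s-density of E at y is positive, then for every t ∈ [0,1] the upper s-density of E at the point t·x + (1−t)·y is positive. -/

import Mathlib

open MeasureTheory Set Metric Filter
open scoped ENNReal

/-- A set `E ⊆ ℝ^d` is mid-point convex if the midpoint of any two of its points
belongs to it. -/
def MidpointConvexSet {d : ℕ} (E : Set (EuclideanSpace ℝ (Fin d))) : Prop :=
  ∀ x ∈ E, ∀ y ∈ E, midpoint ℝ x y ∈ E

/-- A set `E ⊆ ℝ^d` is essentially convex if there are an integer `1 ≤ s ≤ d` and an affine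
subspace `L` of dimension `s` containing `E` such that, in the subspace topology of `L`,
`E` has nonempty interior and `convexHull E \ E` lies in the frontier of `convexHull E`. -/
def EssentiallyConvex {d : ℕ} (E : Set (EuclideanSpace ℝ (Fin d))) : Prop :=
  ∃ s : ℕ, 1 ≤ s ∧ s ≤ d ∧
    ∃ L : AffineSubspace ℝ (EuclideanSpace ℝ (Fin d)),
      Module.finrank ℝ L.direction = s ∧
      E ⊆ (L : Set (EuclideanSpace ℝ (Fin d))) ∧
      (interior ((Subtype.val : L → EuclideanSpace ℝ (Fin d)) ⁻¹' E)).Nonempty ∧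
      (Subtype.val : L → EuclideanSpace ℝ (Fin d)) ⁻¹' (convexHull ℝ E \ E) ⊆
        frontier ((Subtype.val : L → EuclideanSpace ℝ (Fin d)) ⁻¹' (convexHull ℝ E))


/-- The upper `s`-density of `E` at `x`:
`D̄^s(E,x) = limsup_{r→0+} H^s(E ∩ B̄(x,r)) / (2r)^s`. -/
noncomputable def upperDensity {d : ℕ} (s : ℝ) (E : Set (EuclideanSpace ℝ (Fin d)))
    (x : EuclideanSpace ℝ (Fin d)) : ℝ≥0∞ :=
  limsup (fun r : ℝ => μH[s] (E ∩ closedBall x r) / ENNReal.ofReal ((2 * r) ^ s))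
    (nhdsWithin 0 (Ioi 0))

open AffineMap in
/-- A mid-point convex set contains all dyadic combinations of its points. -/
theorem MidpointConvexSet.homothety_dyadic_mem {d : ℕ} {E : Set (EuclideanSpace ℝ (Fin d))}
    (hmid : MidpointConvexSet E) {x e : EuclideanSpace ℝ (Fin d)} (hx : x ∈ E) (he : e ∈ E)
    (n k : ℕ) (hk : k ≤ 2 ^ n) : homothety x ((k : ℝ) / 2 ^ n) e ∈ E := by
  induction n generalizing k with
  | zero =>
    have hk' : k = 0 ∨ k = 1 := by simp at hk; omega
    rcases hk' with rfl | rfl <;> simpa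
  | succ n ih =>
    rcases le_total k (2 ^ n) with h | h
    · convert hmid x hx _ (ih k h) using 1
      simp only [homothety_apply, midpoint_eq_smul_add, vsub_eq_sub, vadd_eq_add, pow_succ,
        invOf_eq_inv]
      module
    · obtain ⟨j, rfl⟩ := Nat.exists_eq_add_of_le h
      convert hmid e he _ (ih j (by rw [pow_succ] at hk; omega)) using 1
      have h2 : ((2 ^ n + j : ℕ) : ℝ) / 2 ^ (n + 1) = (1 + (j : ℝ) / 2 ^ n) / 2 := by
        push_cast
        field_simp
        ring
      rw [h2]
      simp only [homothety_apply, midpoint_eq_smul_add, vsub_eq_sub, vadd_eq_add, invOf_eq_inv]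
      module

/-- Contracting `E` towards one of its points by a dyadic ratio bounds the measure of `E` in a
ball from below by the rescaled measure of `E` in another ball. -/
theorem MidpointConvexSet.hausdorffMeasure_inter_closedBall_ge {d : ℕ} {s : ℝ} (hs : 0 < s)
    {E : Set (EuclideanSpace ℝ (Fin d))} (hmid : MidpointConvexSet E)
    {x : EuclideanSpace ℝ (Fin d)} (hx : x ∈ E) (y z : EuclideanSpace ℝ (Fin d))
    {n k : ℕ} {u : ℝ} (hu : u = (k : ℝ) / 2 ^ n) (hu0 : 0 < u) (hk : k ≤ 2 ^ n) {r ρ : ℝ}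
    (hρ : u * r + dist (AffineMap.homothety x u y) z ≤ ρ) :
    ENNReal.ofReal (u ^ s) * μH[s] (E ∩ closedBall y r) ≤ μH[s] (E ∩ closedBall z ρ) := by
  have himage : μH[s] (AffineMap.homothety x u '' (E ∩ closedBall y r)) =
      ENNReal.ofReal (u ^ s) * μH[s] (E ∩ closedBall y r) := by
    rw [hausdorffMeasure_homothety_image hs.le x hu0.ne', ENNReal.smul_def, smul_eq_mul]
    congr 1
    rw [← ENNReal.ofReal_coe_nnreal, NNReal.coe_rpow, coe_nnnorm, Real.norm_of_nonneg hu0.le]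
  rw [← himage]
  refine measure_mono ?_
  rintro _ ⟨e, ⟨heE, heB⟩, rfl⟩
  refine ⟨hu ▸ hmid.homothety_dyadic_mem hx heE n k hk, ?_⟩
  rw [mem_closedBall] at heB ⊢
  have hdist : dist (AffineMap.homothety x u e) (AffineMap.homothety x u y) = u * dist e y := by
    rw [dist_eq_norm, dist_eq_norm, ← Real.norm_of_nonneg hu0.le, ← norm_smul,
      Real.norm_of_nonneg hu0.le]
    congr 1
    simp only [AffineMap.homothety_apply, vsub_eq_sub, vadd_eq_add]
    module
  have := dist_triangle (AffineMap.homothety x u e) (AffineMap.homothety x u y) z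
  have := mul_le_mul_of_nonneg_left heB hu0.le
  linarith

theorem upperDensity_pos_of_frequently {d : ℕ} {s : ℝ} {E : Set (EuclideanSpace ℝ (Fin d))}
    {x : EuclideanSpace ℝ (Fin d)} {c : ℝ≥0∞} (hc : 0 < c)
    (h : ∃ᶠ r in nhdsWithin (0 : ℝ) (Ioi 0),
      c ≤ μH[s] (E ∩ closedBall x r) / ENNReal.ofReal ((2 * r) ^ s)) :
    0 < upperDensity s E x :=
  hc.trans_le (le_limsup_of_frequently_le h)

theorem exists_frequently_of_upperDensity_pos {d : ℕ} {s : ℝ}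
    {E : Set (EuclideanSpace ℝ (Fin d))} {y : EuclideanSpace ℝ (Fin d)}
    (h : 0 < upperDensity s E y) :
    ∃ c : ℝ≥0∞, 0 < c ∧ ∃ᶠ r in nhdsWithin (0 : ℝ) (Ioi 0),
      c ≤ μH[s] (E ∩ closedBall y r) / ENNReal.ofReal ((2 * r) ^ s) := by
  obtain ⟨c, hc, hlt⟩ := exists_between h
  exact ⟨c, hc, (frequently_lt_of_lt_limsup (by isBoundedDefault) hlt).mono fun _ h => h.le⟩

theorem mul_div_ofReal_rpow_le {s v r ρ : ℝ} (hv : 0 < v) (hr : 0 < r) (hρ : 0 < ρ)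
    {A B : ℝ≥0∞} (h : ENNReal.ofReal (v ^ s) * A ≤ B) :
    ENNReal.ofReal ((v * r / ρ) ^ s) * (A / ENNReal.ofReal ((2 * r) ^ s)) ≤
      B / ENNReal.ofReal ((2 * ρ) ^ s) := by
  have hr' : (0 : ℝ) < (2 * r) ^ s := by positivity
  have hρ' : (0 : ℝ) < (2 * ρ) ^ s := by positivity
  have hscale : ENNReal.ofReal ((v * r / ρ) ^ s) =
      ENNReal.ofReal (v ^ s) * ENNReal.ofReal ((2 * r) ^ s) / ENNReal.ofReal ((2 * ρ) ^ s) := by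
    rw [← ENNReal.ofReal_mul (by positivity), ← ENNReal.ofReal_div_of_pos hρ',
      ← Real.mul_rpow hv.le (by positivity), ← Real.div_rpow (by positivity) (by positivity)]
    congr 2
    field_simp
  have hcancel : ENNReal.ofReal ((2 * r) ^ s) * (A / ENNReal.ofReal ((2 * r) ^ s)) = A :=
    ENNReal.mul_div_cancel (ENNReal.ofReal_pos.2 hr').ne' ENNReal.ofReal_ne_top
  calc _ = ENNReal.ofReal (v ^ s) *
        (ENNReal.ofReal ((2 * r) ^ s) * (A / ENNReal.ofReal ((2 * r) ^ s))) /
          ENNReal.ofReal ((2 * ρ) ^ s) := by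
        rw [hscale]
        simp only [div_eq_mul_inv]
        ring
    _ ≤ _ := by
        rw [hcancel]
        gcongr

theorem exists_dyadic_approx {a ε D : ℝ} (ha : 0 < a) (ha1 : a ≤ 1) (hε : 0 < ε) (hD : 0 ≤ D) :
    ∃ n k : ℕ, k ≤ 2 ^ n ∧ a ≤ (k : ℝ) / 2 ^ n ∧ ((k : ℝ) / 2 ^ n - a) * D ≤ ε := by
  obtain ⟨n, hn⟩ := pow_unbounded_of_one_lt (D / ε) (one_lt_two (α := ℝ))
  have hp : (0 : ℝ) < 2 ^ n := by positivity
  refine ⟨n, ⌈a * 2 ^ n⌉₊, ?_, ?_, ?_⟩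
  · rw [Nat.ceil_le]
    push_cast
    nlinarith
  · rw [le_div_iff₀ hp]
    exact Nat.le_ceil _
  · have h1 := Nat.ceil_lt_add_one (mul_pos ha hp).le
    have h2 : (⌈a * 2 ^ n⌉₊ : ℝ) / 2 ^ n - a ≤ 1 / 2 ^ n := by
      rw [sub_le_iff_le_add, div_le_iff₀ hp, add_mul, one_div, inv_mul_cancel₀ hp.ne']
      linarith
    have h3 : D < 2 ^ n * ε := (div_lt_iff₀ hε).1 hn
    calc _ ≤ 1 / 2 ^ n * D := by gcongr
      _ ≤ ε := by
        rw [one_div, inv_mul_le_iff₀ hp]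
        exact h3.le

theorem MidpointConvexSet.upperDensity_pos_endpoint {d : ℕ} {s : ℝ} (hs : 0 < s)
    {E : Set (EuclideanSpace ℝ (Fin d))} (hmid : MidpointConvexSet E)
    {x y : EuclideanSpace ℝ (Fin d)} (hx : x ∈ E) (hDy : 0 < upperDensity s E y) :
    0 < upperDensity s E x := by
  obtain ⟨c, hc, hfreq⟩ := exists_frequently_of_upperDensity_pos hDy
  obtain ⟨r, hcr, hr : 0 < r⟩ := (hfreq.and_eventually self_mem_nhdsWithin).exists
  have hR : 0 < dist y x + r := by positivity
  have htendsto : Tendsto (fun n : ℕ => (1 / 2 : ℝ) ^ n * (dist y x + r)) atTop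
      (nhdsWithin 0 (Ioi 0)) := by
    refine tendsto_nhdsWithin_iff.2 ⟨?_, Eventually.of_forall fun n => ?_⟩
    · simpa using (tendsto_pow_atTop_nhds_zero_of_lt_one (by norm_num : (0 : ℝ) ≤ 1 / 2)
        (by norm_num)).mul_const (dist y x + r)
    · exact mem_Ioi.2 (by positivity)
  refine upperDensity_pos_of_frequently
    (c := ENNReal.ofReal ((r / (dist y x + r)) ^ s) * c) ?_
    (htendsto.frequently (Frequently.of_forall fun n => ?_))
  · exact ENNReal.mul_pos (ENNReal.ofReal_pos.2 (by positivity)).ne' hc.ne'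
  · have hu0 : (0 : ℝ) < (1 / 2) ^ n := by positivity
    have hmeas := hmid.hausdorffMeasure_inter_closedBall_ge hs hx y x (n := n) (k := 1)
      (u := (1 / 2) ^ n) (by simp) hu0 Nat.one_le_two_pow (r := r)
      (ρ := (1 / 2 : ℝ) ^ n * (dist y x + r)) (by
        rw [dist_homothety_center, Real.norm_of_nonneg hu0.le, dist_comm x y]
        linarith)
    refine le_trans ?_ (mul_div_ofReal_rpow_le hu0 hr (by positivity) hmeas)
    rw [mul_div_mul_left _ _ hu0.ne']
    gcongr

theorem upperDensity_pos_on_segment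
    (d : ℕ) (s : ℝ) (hs : 0 < s)
    (E : Set (EuclideanSpace ℝ (Fin d))) (hE : MeasurableSet E)
    (hmid : MidpointConvexSet E)
    (x y : EuclideanSpace ℝ (Fin d)) (hx : x ∈ E) (hy : y ∈ E)
    (hDy : 0 < upperDensity s E y) :
    ∀ t ∈ Icc (0 : ℝ) 1, 0 < upperDensity s E (t • x + (1 - t) • y) := by
  rintro t ⟨ht0, ht1⟩
  rcases ht1.eq_or_lt with rfl | ht1
  · simpa using hmid.upperDensity_pos_endpoint hs hx hDy
  have ha : 0 < 1 - t := sub_pos.2 ht1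
  obtain ⟨c, hc, hfreq⟩ := exists_frequently_of_upperDensity_pos hDy
  have htendsto : Tendsto (fun r : ℝ => 2 * r) (nhdsWithin 0 (Ioi 0))
      (nhdsWithin 0 (Ioi 0)) := by
    refine tendsto_nhdsWithin_iff.2 ⟨?_, ?_⟩
    · exact (Continuous.tendsto' (by fun_prop) _ _ (by simp)).mono_left nhdsWithin_le_nhds
    · filter_upwards [self_mem_nhdsWithin] with r hr
      exact mul_pos two_pos (mem_Ioi.1 hr)
  refine upperDensity_pos_of_frequently (c := ENNReal.ofReal (((1 - t) / 2) ^ s) * c) ?_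
    (htendsto.frequently ((hfreq.and_eventually self_mem_nhdsWithin).mono ?_))
  · exact ENNReal.mul_pos (ENNReal.ofReal_pos.2 (by positivity)).ne' hc.ne'
  rintro r ⟨hcr, hr : 0 < r⟩
  obtain ⟨n, k, hk, hak, hclose⟩ :=
    exists_dyadic_approx ha (by linarith) hr (dist_nonneg (x := y) (y := x))
  set u : ℝ := (k : ℝ) / 2 ^ n with hu
  have hu0 : 0 < u := ha.trans_le hak
  have hu1 : u ≤ 1 := by
    rw [hu, div_le_one (by positivity)]
    exact_mod_cast hk
  have hdist : dist (AffineMap.homothety x u y) (t • x + (1 - t) • y) =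
      (u - (1 - t)) * dist y x := by
    rw [dist_eq_norm, dist_eq_norm, ← Real.norm_of_nonneg (sub_nonneg.2 hak), ← norm_smul]
    congr 1
    simp only [AffineMap.homothety_apply, vsub_eq_sub, vadd_eq_add]
    module
  have hmeas := hmid.hausdorffMeasure_inter_closedBall_ge hs hx y (t • x + (1 - t) • y)
    hu hu0 hk (r := r) (ρ := 2 * r) (by
      rw [hdist]
      nlinarith)
  refine le_trans ?_ (mul_div_ofReal_rpow_le hu0 hr (by positivity) hmeas)
  rw [mul_div_mul_right _ _ hr.ne']
  gcongr
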